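/- arXiv:2006.08778 — 5 statements merged into one kernel-verified Lean document; each statement's English description precedes it below -/
import Mathlib

section
/- For all real numbers a > 0, k > 0 and r > 0, the integral ∫_r^∞ x · (1 − exp(−a e^{−k x} / x²)) dx is finite and equals the series Σ_{l=1}^∞ (−1)^{l+1} (a^l / l!) · (l k)^{2l−2} · Γ(2 − 2l, l k r), and this series converges absolutely. -/
open Real MeasureTheory Set

/-- Upper incomplete gamma function `Γ(s, y) = ∫_y^∞ t^(s-1) e^(-t) dt`. -/
noncomputable def uGamma (s y : ℝ) : ℝ := ∫ t in Set.Ioi y, t ^ (s - 1) * Real.exp (-t)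

lemma aux_u (a k r : ℝ) (ha : 0 < a) (hk : 0 < k) (hr : 0 < r) (x : ℝ) (hx : r < x) :
    0 < a * Real.exp (-(k * x)) / x ^ 2 ∧ a * Real.exp (-(k * x)) / x ^ 2 ≤ a / r ^ 2 ∧
    x * (a * Real.exp (-(k * x)) / x ^ 2) ≤ (a / r) * Real.exp (-k * x) := by
  have hx0 : 0 < x := hr.trans hx
  refine ⟨by positivity, ?_, ?_⟩
  · have h1 : Real.exp (-(k * x)) ≤ 1 := Real.exp_le_one_iff.2 (by nlinarith [mul_pos hk hx0])
    calc a * Real.exp (-(k * x)) / x ^ 2 ≤ a * 1 / r ^ 2 := by gcongr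
      _ = a / r ^ 2 := by ring
  · have : x * (a * Real.exp (-(k * x)) / x ^ 2) = (a / x) * Real.exp (-k * x) := by
      rw [neg_mul]; field_simp
    rw [this]
    gcongr

lemma aux_meas (a k r : ℝ) (hr : 0 < r) : ContinuousOn
    (fun x : ℝ => a * Real.exp (-(k * x)) / x ^ 2) (Set.Ioi r) := by
  apply ContinuousOn.div (by fun_prop) (by fun_prop)
  intro x hx
  have : 0 < x := hr.trans hx
  positivity

lemma aux_exp (u : ℝ) : HasSum (fun n : ℕ => (-1 : ℝ) ^ n / (Nat.factorial (n + 1) : ℝ) * u ^ (n + 1))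
    (1 - Real.exp (-u)) := by
  have h := NormedSpace.expSeries_div_hasSum_exp (-u)
  rw [← Real.exp_eq_exp_ℝ] at h
  have h2 := ((hasSum_nat_add_iff' 1).2 h).neg
  have e1 : (fun n : ℕ => (-1 : ℝ) ^ n / (Nat.factorial (n + 1) : ℝ) * u ^ (n + 1)) =
      fun n : ℕ => -((-u) ^ (n + 1) / (Nat.factorial (n + 1) : ℝ)) := by
    funext n
    rw [neg_pow u (n + 1)]; ring
  have e2 : 1 - Real.exp (-u) = -(Real.exp (-u) -
      ∑ i ∈ Finset.range 1, (-u) ^ i / (Nat.factorial i : ℝ)) := by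
    simp
  rw [e1, e2]
  exact h2

lemma aux_int (a k r : ℝ) (hk : 0 < k) (hr : 0 < r) (n : ℕ) :
    (∫ x in Set.Ioi r, x * ((-1 : ℝ) ^ n / (Nat.factorial (n + 1) : ℝ) *
      (a * Real.exp (-(k * x)) / x ^ 2) ^ (n + 1))) =
    (-1 : ℝ) ^ n * (a ^ (n + 1) / (Nat.factorial (n + 1) : ℝ)) *
          (((n : ℝ) + 1) * k) ^ (2 * n) *
          uGamma (2 - 2 * ((n : ℝ) + 1)) (((n : ℝ) + 1) * k * r) := by
  have hb : 0 < ((n : ℝ) + 1) * k := by positivity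
  unfold uGamma
  rw [← integral_comp_mul_left_Ioi' _ _ hb, smul_eq_mul, ← integral_const_mul, ← integral_const_mul]
  apply setIntegral_congr_fun measurableSet_Ioi
  intro x hx
  have hx0 : 0 < x := hr.trans hx
  have hbx := mul_pos hb hx0
  have e1 : (((n : ℝ) + 1) * k * x) ^ ((2 : ℝ) - 2 * ((n : ℝ) + 1) - 1) =
      ((((n : ℝ) + 1) * k * x) ^ (2 * n + 1))⁻¹ := by
    rw [← Real.rpow_natCast, ← Real.rpow_neg hbx.le]
    congr 1
    push_cast; ring
  have e2 : Real.exp (-(k * x)) ^ (n + 1) = Real.exp (-(((n : ℝ) + 1) * k * x)) := by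
    rw [← Real.exp_nat_mul]
    congr 1
    push_cast; ring
  simp only [e1, div_pow, mul_pow a, e2]
  generalize Real.exp (-(((n : ℝ) + 1) * k * x)) = E
  rw [mul_pow _ x]
  generalize ((n : ℝ) + 1) * k = b at *
  have hb' := hb.ne'
  have : (Nat.factorial (n + 1) : ℝ) ≠ 0 := by positivity
  field_simp
  ring

/-- For `a, k, r > 0`, the integral `∫_r^∞ x (1 − exp(−a e^{−k x}/x²)) dx` is finite and
equals `Σ_{l=1}^∞ (−1)^{l+1} (a^l / l!) (l k)^{2l−2} Γ(2 − 2l, l k r)`, and the series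
converges absolutely. (The sum over `l ≥ 1` is written as a sum over `n : ℕ` with
`l = n + 1`, so that `(−1)^{l+1} = (−1)^n` and `2l − 2 = 2n`.) -/
theorem stmt0 (a k r : ℝ) (ha : 0 < a) (hk : 0 < k) (hr : 0 < r) :
    MeasureTheory.IntegrableOn
      (fun x : ℝ => x * (1 - Real.exp (-(a * Real.exp (-(k * x)) / x ^ 2)))) (Set.Ioi r) ∧
    (∫ x in Set.Ioi r, x * (1 - Real.exp (-(a * Real.exp (-(k * x)) / x ^ 2)))) =
      ∑' n : ℕ,
        (-1 : ℝ) ^ n * (a ^ (n + 1) / (Nat.factorial (n + 1) : ℝ)) *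
          (((n : ℝ) + 1) * k) ^ (2 * n) *
          uGamma (2 - 2 * ((n : ℝ) + 1)) (((n : ℝ) + 1) * k * r) ∧
    Summable (fun n : ℕ =>
        |(-1 : ℝ) ^ n * (a ^ (n + 1) / (Nat.factorial (n + 1) : ℝ)) *
          (((n : ℝ) + 1) * k) ^ (2 * n) *
          uGamma (2 - 2 * ((n : ℝ) + 1)) (((n : ℝ) + 1) * k * r)|) := by
  have hE : IntegrableOn (fun x : ℝ => (a / r) * Real.exp (-k * x)) (Set.Ioi r) :=
    (integrableOn_exp_mul_Ioi (neg_lt_zero.2 hk) r).const_mul _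
  have hc := aux_meas a k r hr
  have hF : ∀ n : ℕ, ∀ x ∈ Set.Ioi r, ‖x * ((-1 : ℝ) ^ n / (Nat.factorial (n + 1) : ℝ) *
      (a * Real.exp (-(k * x)) / x ^ 2) ^ (n + 1))‖ ≤
      ((a / r ^ 2) ^ n / (Nat.factorial n : ℝ)) * ((a / r) * Real.exp (-k * x)) := by
    intro n x hx
    obtain ⟨h0, h1, h2⟩ := aux_u a k r ha hk hr x hx
    have hx0 : 0 < x := hr.trans hx
    generalize a * Real.exp (-(k * x)) / x ^ 2 = u at *
    rw [norm_mul, norm_mul, norm_div, norm_pow, norm_neg, norm_one, one_pow, norm_pow,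
      Real.norm_of_nonneg hx0.le, Real.norm_of_nonneg h0.le, Real.norm_natCast]
    have hf : (Nat.factorial n : ℝ) ≤ (Nat.factorial (n + 1) : ℝ) := by
      exact_mod_cast Nat.factorial_le (Nat.le_succ n)
    calc x * (1 / (Nat.factorial (n + 1) : ℝ) * u ^ (n + 1))
        = u ^ n / (Nat.factorial (n + 1) : ℝ) * (x * u) := by ring
      _ ≤ _ := by gcongr
  have hFi : ∀ n : ℕ, IntegrableOn (fun x => x * ((-1 : ℝ) ^ n / (Nat.factorial (n + 1) : ℝ) *
      (a * Real.exp (-(k * x)) / x ^ 2) ^ (n + 1))) (Set.Ioi r) := by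
    intro n
    refine Integrable.mono' (hE.const_mul ((a / r ^ 2) ^ n / (Nat.factorial n : ℝ))) ?_ ?_
    · exact (continuousOn_id.mul (continuousOn_const.mul (hc.pow _))).aestronglyMeasurable
        measurableSet_Ioi
    · exact (ae_restrict_iff' measurableSet_Ioi).2 (ae_of_all _ (hF n))
  have hS : Summable (fun n : ℕ => ∫ x in Set.Ioi r, ‖x * ((-1 : ℝ) ^ n /
      (Nat.factorial (n + 1) : ℝ) * (a * Real.exp (-(k * x)) / x ^ 2) ^ (n + 1))‖) := by
    refine Summable.of_nonneg_of_le (fun n => integral_nonneg fun x => norm_nonneg _) (fun n => ?_)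
      ((Real.summable_pow_div_factorial (a / r ^ 2)).mul_right
        (∫ x in Set.Ioi r, (a / r) * Real.exp (-k * x)))
    rw [← integral_const_mul]
    exact setIntegral_mono_on (hFi n).norm (hE.const_mul _) measurableSet_Ioi (hF n)
  have hH := hasSum_integral_of_summable_integral_norm hFi hS
  simp only [aux_int a k r hk hr, tsum_mul_left, (aux_exp _).tsum_eq] at hH
  refine ⟨?_, hH.tsum_eq.symm, hH.summable.abs⟩
  refine Integrable.mono' hE ?_ ?_
  · exact (continuousOn_id.mul (continuousOn_const.sub
      (Real.continuous_exp.comp_continuousOn hc.neg))).aestronglyMeasurable measurableSet_Ioi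
  · refine (ae_restrict_iff' measurableSet_Ioi).2 (ae_of_all _ fun x hx => ?_)
    obtain ⟨h0, h1, h2⟩ := aux_u a k r ha hk hr x hx
    have hx0 : 0 < x := hr.trans hx
    refine le_trans ?_ h2
    generalize a * Real.exp (-(k * x)) / x ^ 2 = u at *
    have h3 : Real.exp (-u) ≤ 1 := Real.exp_le_one_iff.2 (by linarith)
    have h4 := Real.add_one_le_exp (-u)
    rw [Real.norm_of_nonneg (mul_nonneg hx0.le (by linarith))]
    gcongr
    linarith
end

section
/- For all real numbers a > 0, k > 0 and r > 0, the series Σ_{l=1}^∞ (a^l / l!) · (l k)^{2l−2} · Γ(2 − 2l, l k r) is summable; moreover each term satisfies the bound (a^l / l!) (l k)^{2l−2} Γ(2 − 2l, l k r) ≤ (r / (l k)) · (a e^{−k r} / r²)^l / l!. -/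
open Real MeasureTheory Set

lemma uGamma_nonneg_aux (s y : ℝ) (hy : 0 < y) : 0 ≤ uGamma s y := by
  unfold uGamma
  refine setIntegral_nonneg measurableSet_Ioi fun t ht => ?_
  have : 0 < t := hy.trans ht
  positivity

lemma uGamma_le_aux (s y : ℝ) (hy : 0 < y) (hs : s ≤ 1) :
    uGamma s y ≤ y ^ (s - 1) * Real.exp (-y) := by
  unfold uGamma
  rw [← integral_exp_neg_Ioi y, ← integral_const_mul]
  have hi : IntegrableOn (fun t : ℝ => y ^ (s - 1) * Real.exp (-t)) (Set.Ioi y) :=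
    (integrableOn_exp_neg_Ioi y).const_mul _
  refine integral_mono_of_nonneg ?_ hi ?_
  · refine (ae_restrict_iff' measurableSet_Ioi).2 (Filter.Eventually.of_forall fun t ht => ?_)
    have : 0 < t := hy.trans ht
    simp only [Pi.zero_apply]
    positivity
  · refine (ae_restrict_iff' measurableSet_Ioi).2 (Filter.Eventually.of_forall fun t ht => ?_)
    exact mul_le_mul_of_nonneg_right
      (Real.rpow_le_rpow_of_nonpos hy (le_of_lt ht) (by linarith)) (Real.exp_pos _).le

lemma term_le_aux (a k r : ℝ) (ha : 0 < a) (hk : 0 < k) (hr : 0 < r) (n : ℕ) :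
    (a ^ (n + 1) / (Nat.factorial (n + 1) : ℝ)) * (((n : ℝ) + 1) * k) ^ (2 * n) *
          uGamma (2 - 2 * ((n : ℝ) + 1)) (((n : ℝ) + 1) * k * r) ≤
        (r / (((n : ℝ) + 1) * k)) * (a * Real.exp (-(k * r)) / r ^ 2) ^ (n + 1) /
          (Nat.factorial (n + 1) : ℝ) := by
  have hy : 0 < ((n : ℝ) + 1) * k * r := by positivity
  have hn : (0 : ℝ) ≤ n := Nat.cast_nonneg n
  have h := uGamma_le_aux (2 - 2 * ((n : ℝ) + 1)) _ hy (by linarith)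
  refine (mul_le_mul_of_nonneg_left h (by positivity)).trans (le_of_eq ?_)
  have e1 : (2 - 2 * ((n : ℝ) + 1) - 1) = -((2 * n + 1 : ℕ) : ℝ) := by push_cast; ring
  have e2 : Real.exp (-(((n : ℝ) + 1) * k * r)) = Real.exp (-(k * r)) ^ (n + 1) := by
    rw [← Real.exp_nat_mul]; congr 1; push_cast; ring
  rw [e1, Real.rpow_neg hy.le, Real.rpow_natCast, e2]
  have hf : (0 : ℝ) < (Nat.factorial (n + 1) : ℝ) := by positivity
  have hm : (0 : ℝ) < (n : ℝ) + 1 := by positivity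
  generalize (Nat.factorial (n + 1) : ℝ) = F at *
  generalize Real.exp (-(k * r)) = E at *
  generalize (n : ℝ) + 1 = m at *
  rw [div_pow, mul_pow a E, mul_pow (m * k) r, pow_succ (m * k), ← pow_mul]
  have : r ^ (2 * (n + 1)) = r ^ (2 * n + 1) * r := by ring
  rw [this]
  have hmk : 0 < m * k := by positivity
  generalize m * k = q at *
  field_simp

/-- For `a, k, r > 0`, the series `Σ_{l=1}^∞ (a^l / l!) (l k)^{2l−2} Γ(2 − 2l, l k r)` is
summable (indexed by `n : ℕ` with `l = n + 1`), and each term (for `l ≥ 1`) satisfies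
`(a^l / l!) (l k)^{2l−2} Γ(2 − 2l, l k r) ≤ (r / (l k)) (a e^{−k r} / r²)^l / l!`. -/
theorem stmt1 (a k r : ℝ) (ha : 0 < a) (hk : 0 < k) (hr : 0 < r) :
    Summable (fun n : ℕ =>
        (a ^ (n + 1) / (Nat.factorial (n + 1) : ℝ)) * (((n : ℝ) + 1) * k) ^ (2 * n) *
          uGamma (2 - 2 * ((n : ℝ) + 1)) (((n : ℝ) + 1) * k * r)) ∧
    ∀ l : ℕ, 1 ≤ l →
      (a ^ l / (Nat.factorial l : ℝ)) * ((l : ℝ) * k) ^ (2 * l - 2) *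
          uGamma (2 - 2 * (l : ℝ)) ((l : ℝ) * k * r) ≤
        (r / ((l : ℝ) * k)) * (a * Real.exp (-(k * r)) / r ^ 2) ^ l /
          (Nat.factorial l : ℝ) := by
  constructor
  · have hs : Summable (fun n : ℕ => (r / k) *
        ((a * Real.exp (-(k * r)) / r ^ 2) ^ (n + 1) / (Nat.factorial (n + 1) : ℝ))) :=
      ((summable_nat_add_iff 1).2
        (Real.summable_pow_div_factorial (a * Real.exp (-(k * r)) / r ^ 2))).mul_left _
    refine Summable.of_nonneg_of_le (fun n => ?_) (fun n => ?_) hs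
    · have := uGamma_nonneg_aux (2 - 2 * ((n : ℝ) + 1)) (((n : ℝ) + 1) * k * r) (by positivity)
      positivity
    · refine (term_le_aux a k r ha hk hr n).trans ?_
      rw [mul_div_assoc]
      refine mul_le_mul_of_nonneg_right ?_ (by positivity)
      refine div_le_div_of_nonneg_left hr.le hk ?_
      have : (0 : ℝ) ≤ n := Nat.cast_nonneg n
      nlinarith
  · intro l hl
    obtain ⟨n, rfl⟩ : ∃ n, l = n + 1 := ⟨l - 1, by omega⟩
    have := term_le_aux a k r ha hk hr n
    have e : 2 * (n + 1) - 2 = 2 * n := by omega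
    rw [e]
    push_cast at this ⊢
    exact this
end

section
/- For all real numbers α > 2, A ≥ 0 and β > 0, ∫_0^∞ 2 β r · exp(−A r^{4/α} − β r²) dr = Σ_{j=0}^∞ ((−1)^j A^j / (j! · β^{2j/α})) · Γ(2j/α + 1), and the series on the right-hand side converges absolutely. -/
open Real MeasureTheory Set

lemma aux_sum (s C : ℝ) (hs1 : s < 1) (hC : 0 ≤ C) :
    Summable (fun j : ℕ => C ^ j * (Nat.factorial j : ℝ) ^ (-(1 - s))) := by
  refine summable_of_ratio_norm_eventually_le (r := 1 / 2) (by norm_num) ?_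
  have h1 : Filter.Tendsto (fun n : ℕ => C * ((n + 1 : ℕ) : ℝ) ^ (-(1 - s))) Filter.atTop
      (nhds (C * 0)) :=
    (((tendsto_rpow_neg_atTop (by linarith : 0 < 1 - s)).comp
      (tendsto_natCast_atTop_atTop (R := ℝ))).comp (Filter.tendsto_add_atTop_nat 1)).const_mul C
  rw [mul_zero] at h1
  filter_upwards [h1.eventually_le_const (by norm_num : (0 : ℝ) < 1 / 2)] with n hn
  rw [Real.norm_of_nonneg (by positivity), Real.norm_of_nonneg (by positivity),
    Nat.factorial_succ, Nat.cast_mul, Real.mul_rpow (by positivity) (by positivity), pow_succ]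
  calc _ = (C * ((n + 1 : ℕ) : ℝ) ^ (-(1 - s))) *
        (C ^ n * (Nat.factorial n : ℝ) ^ (-(1 - s))) := by ring
    _ ≤ _ := mul_le_mul_of_nonneg_right hn (by positivity)

lemma aux_gamma (s : ℝ) (hs0 : 0 < s) (hs1 : s < 1) (j : ℕ) :
    Real.Gamma (s * j + 1) ≤ (Nat.factorial j : ℝ) ^ s := by
  have h := Real.Gamma_mul_add_mul_le_rpow_Gamma_mul_rpow_Gamma (s := 1) (t := (j : ℝ) + 1)
    (a := 1 - s) (b := s) one_pos (by positivity) (by linarith) hs0 (by ring)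
  rw [Real.Gamma_one, Real.one_rpow, one_mul, Real.Gamma_nat_eq_factorial] at h
  convert h using 2
  ring

lemma aux_summable (α A β : ℝ) (hα : 2 < α) (hA : 0 ≤ A) (hβ : 0 < β) :
    Summable (fun j : ℕ =>
        |(-1 : ℝ) ^ j * A ^ j / ((Nat.factorial j : ℝ) * β ^ (2 * (j : ℝ) / α)) *
          Real.Gamma (2 * (j : ℝ) / α + 1)|) := by
  have hs0 : 0 < 2 / α := by positivity
  have hs1 : 2 / α < 1 := by rw [div_lt_one (by linarith)]; exact hα
  refine Summable.of_nonneg_of_le (fun _ => abs_nonneg _) (fun j => ?_)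
    (aux_sum (2 / α) (A / β ^ (2 / α)) hs1 (by positivity))
  have e : 2 * (j : ℝ) / α = 2 / α * j := by ring
  have hG : 0 < Real.Gamma (2 / α * j + 1) := Real.Gamma_pos_of_pos (by positivity)
  have hf : (0 : ℝ) < Nat.factorial j := by positivity
  rw [e, abs_mul, abs_div, abs_mul, abs_pow, abs_neg, abs_one, one_pow, one_mul,
    abs_of_nonneg (pow_nonneg hA j), abs_of_pos hG,
    abs_of_pos (by positivity : 0 < (Nat.factorial j : ℝ) * β ^ (2 / α * (j : ℝ))),
    Real.rpow_mul hβ.le, Real.rpow_natCast, div_pow, neg_sub, Real.rpow_sub_one hf.ne']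
  calc _ ≤ A ^ j / ((Nat.factorial j : ℝ) * (β ^ (2 / α)) ^ j) * (Nat.factorial j : ℝ) ^ (2 / α) :=
        mul_le_mul_of_nonneg_left (aux_gamma _ hs0 hs1 j) (by positivity)
    _ = _ := by field_simp

lemma aux_int_s6 (α β : ℝ) (hα : 2 < α) (hβ : 0 < β) (j : ℕ) :
    2 * β * ∫ r in Set.Ioi (0 : ℝ), r ^ (1 + 4 * (j : ℝ) / α) * Real.exp (-β * r ^ (2 : ℝ)) =
      (β ^ (2 * (j : ℝ) / α))⁻¹ * Real.Gamma (2 * (j : ℝ) / α + 1) := by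
  have h0 : 0 ≤ 4 * (j : ℝ) / α := by positivity
  rw [integral_rpow_mul_exp_neg_mul_rpow two_pos (by linarith) hβ,
    show (1 + 4 * (j : ℝ) / α + 1) / 2 = 2 * (j : ℝ) / α + 1 by ring,
    show -(1 + 4 * (j : ℝ) / α + 1) / 2 = -(2 * (j : ℝ) / α) - 1 by ring,
    Real.rpow_sub_one hβ.ne', Real.rpow_neg hβ.le]
  field_simp

theorem stmt6 (α A β : ℝ) (hα : 2 < α) (hA : 0 ≤ A) (hβ : 0 < β) :
    (∫ r in Set.Ioi (0 : ℝ),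
        2 * β * r * Real.exp (-(A * r ^ (4 / α)) - β * r ^ 2)) =
      ∑' j : ℕ, (-1 : ℝ) ^ j * A ^ j / ((Nat.factorial j : ℝ) * β ^ (2 * (j : ℝ) / α)) *
        Real.Gamma (2 * (j : ℝ) / α + 1) ∧
    Summable (fun j : ℕ =>
        |(-1 : ℝ) ^ j * A ^ j / ((Nat.factorial j : ℝ) * β ^ (2 * (j : ℝ) / α)) *
          Real.Gamma (2 * (j : ℝ) / α + 1)|) := by
  have hS := aux_summable α A β hα hA hβ
  refine ⟨?_, hS⟩
  let g : ℕ → ℝ → ℝ := fun j r => r ^ (1 + 4 * (j : ℝ) / α) * Real.exp (-β * r ^ (2 : ℝ))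
  let c : ℕ → ℝ := fun j => (-1 : ℝ) ^ j * A ^ j / (Nat.factorial j : ℝ) * (2 * β)
  have hc : ∀ j, c j * ∫ r in Set.Ioi (0 : ℝ), g j r =
      (-1 : ℝ) ^ j * A ^ j / ((Nat.factorial j : ℝ) * β ^ (2 * (j : ℝ) / α)) *
        Real.Gamma (2 * (j : ℝ) / α + 1) := by
    intro j
    have := aux_int_s6 α β hα hβ j
    simp only [c, g]
    rw [mul_assoc, this]
    field_simp
  have hgn : ∀ j, ∀ r ∈ Set.Ioi (0 : ℝ), 0 ≤ g j r := by
    intro j r hr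
    have : (0 : ℝ) < r := hr
    positivity
  have hint : ∀ j, Integrable (fun r => c j * g j r) (volume.restrict (Set.Ioi 0)) := by
    intro j
    have h0 : 0 ≤ 4 * (j : ℝ) / α := by positivity
    exact (integrableOn_rpow_mul_exp_neg_mul_rpow (by linarith) two_pos hβ).const_mul (c j)
  have hnorm : ∀ j, ∫ r in Set.Ioi (0 : ℝ), ‖c j * g j r‖ =
      |(-1 : ℝ) ^ j * A ^ j / ((Nat.factorial j : ℝ) * β ^ (2 * (j : ℝ) / α)) *
          Real.Gamma (2 * (j : ℝ) / α + 1)| := by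
    intro j
    rw [← hc j, abs_mul, abs_of_nonneg (setIntegral_nonneg measurableSet_Ioi (hgn j)),
      ← integral_const_mul]
    refine setIntegral_congr_fun measurableSet_Ioi (fun r hr => ?_)
    simp only [Real.norm_eq_abs, abs_mul, abs_of_nonneg (hgn j r hr)]
  have key := hasSum_integral_of_summable_integral_norm hint (by simpa only [hnorm] using hS)
  simp only [integral_const_mul, hc] at key
  rw [key.tsum_eq]
  refine setIntegral_congr_fun measurableSet_Ioi (fun r hr => ?_)
  have hr0 : (0 : ℝ) < r := hr
  have hE : HasSum (fun n : ℕ => (-(A * r ^ (4 / α))) ^ n / (Nat.factorial n : ℝ))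
      (Real.exp (-(A * r ^ (4 / α)))) := by
    rw [Real.exp_eq_exp_ℝ]
    exact NormedSpace.expSeries_div_hasSum_exp _
  have h2 := hE.mul_left (2 * β * r * Real.exp (-β * r ^ 2))
  have h3 : (fun j => c j * g j r) = fun n : ℕ => 2 * β * r * Real.exp (-β * r ^ 2) *
      ((-(A * r ^ (4 / α))) ^ n / (Nat.factorial n : ℝ)) := by
    funext j
    simp only [c, g]
    rw [Real.rpow_add hr0, Real.rpow_one, show 4 * (j : ℝ) / α = 4 / α * j by ring,
      Real.rpow_mul hr0.le, Real.rpow_natCast, Real.rpow_two, neg_eq_neg_one_mul (A * _),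
      mul_pow, mul_pow]
    ring
  rw [h3, h2.tsum_eq, sub_eq_add_neg, Real.exp_add, neg_mul]
  ring
end

section
/- Fix real numbers α > 0, A ≥ 0 and k ≥ 0. Then lim_{β → ∞} ∫_0^∞ 2 β r · exp(−A r^{4/α} e^{2 k r / α} − β r²) dr = 1. -/
open Real MeasureTheory Set Filter

/-- For fixed `α > 0`, `A ≥ 0`, `k ≥ 0`, the THz association probability
`∫_0^∞ 2βr exp(−A r^{4/α} e^{2kr/α} − βr²) dr` tends to `1` as `β → ∞`. -/
theorem stmt7 (α A k : ℝ) (hα : 0 < α) (hA : 0 ≤ A) (hk : 0 ≤ k) :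
    Filter.Tendsto
      (fun β : ℝ => ∫ r in Set.Ioi (0 : ℝ),
        2 * β * r * Real.exp (-(A * r ^ (4 / α) * Real.exp (2 * k * r / α)) - β * r ^ 2))
      Filter.atTop (nhds 1) := by
  set g : ℝ → ℝ := fun r => Real.exp (-(A * r ^ (4 / α) * Real.exp (2 * k * r / α))) with hg
  have hgc : Continuous g := by
    have : Continuous (fun r : ℝ => r ^ (4 / α)) := Real.continuous_rpow_const (by positivity)
    fun_prop
  have hg0 : g 0 = 1 := by
    have : (4 / α) ≠ 0 := by positivity
    simp [hg, Real.zero_rpow this]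
  have hg1 : ∀ r, 0 ≤ r → g r ≤ 1 := by
    intro r hr
    simp only [hg]
    rw [Real.exp_le_one_iff]
    have : 0 ≤ A * r ^ (4 / α) * Real.exp (2 * k * r / α) := by positivity
    linarith
  have hgp : ∀ r, 0 < g r := fun r => Real.exp_pos _
  have hint : IntegrableOn (fun x : ℝ => 2 * (x * Real.exp (-1 * x ^ 2))) (Ioi 0) :=
    ((integrable_mul_exp_neg_mul_sq one_pos).const_mul 2).integrableOn
  have hval : ∫ x in Ioi (0 : ℝ), 2 * (x * Real.exp (-1 * x ^ 2)) = 1 := by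
    rw [integral_const_mul]
    have h := integral_rpow_mul_exp_neg_mul_rpow (p := 2) (q := 1) (b := 1)
      (by norm_num) (by norm_num) (by norm_num)
    have e : ((1 : ℝ) + 1) / 2 = 1 := by norm_num
    rw [e] at h
    simp only [Real.rpow_one, Real.rpow_two, Real.one_rpow, Real.Gamma_one] at h
    rw [h]; norm_num
  have key : Tendsto (fun β : ℝ => ∫ x in Ioi (0 : ℝ),
      2 * (x * Real.exp (-1 * x ^ 2)) * g ((√β)⁻¹ * x)) atTop
      (nhds (∫ x in Ioi (0 : ℝ), 2 * (x * Real.exp (-1 * x ^ 2)))) := by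
    refine tendsto_integral_filter_of_dominated_convergence
      (fun x : ℝ => 2 * (x * Real.exp (-1 * x ^ 2))) ?_ ?_ hint ?_
    · refine Eventually.of_forall fun β => Continuous.aestronglyMeasurable ?_
      fun_prop
    · refine Eventually.of_forall fun β => ?_
      filter_upwards [ae_restrict_mem measurableSet_Ioi] with x hx
      have hx' : 0 < x := hx
      have h0 : 0 ≤ 2 * (x * Real.exp (-1 * x ^ 2)) := by positivity
      rw [Real.norm_of_nonneg (mul_nonneg h0 (hgp _).le)]
      exact mul_le_of_le_one_right h0 (hg1 _ (by positivity))
    · refine Eventually.of_forall fun x => ?_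
      have h1 : Tendsto (fun β : ℝ => (√β)⁻¹ * x) atTop (nhds 0) := by
        simpa using (tendsto_inv_atTop_zero.comp Real.tendsto_sqrt_atTop).mul_const x
      have h2 := (hgc.tendsto 0).comp h1
      rw [hg0] at h2
      have h3 := h2.const_mul (2 * (x * Real.exp (-1 * x ^ 2)))
      rw [mul_one] at h3
      exact h3
  rw [hval] at key
  refine key.congr' ?_
  filter_upwards [eventually_gt_atTop 0] with β hβ
  have hb : 0 < √β := Real.sqrt_pos.2 hβ
  have h := integral_comp_mul_left_Ioi'
    (fun x => 2 * (x * Real.exp (-1 * x ^ 2)) * g ((√β)⁻¹ * x)) 0 hb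
  rw [mul_zero] at h
  rw [← h, smul_eq_mul, ← integral_const_mul]
  congr 1
  ext r
  have hs : √β ^ 2 = β := Real.sq_sqrt hβ.le
  have e1 : (√β)⁻¹ * (√β * r) = r := by field_simp
  rw [e1, mul_pow, hs, sub_eq_add_neg, Real.exp_add]
  simp only [hg]
  have e2 : -1 * (β * r ^ 2) = -(β * r ^ 2) := by ring
  rw [e2]
  linear_combination (2 * r * Real.exp (-(β * r ^ 2)) *
    Real.exp (-(A * r ^ (4 / α) * Real.exp (2 * k * r / α)))) * hs
end

section
/- For all real numbers α > 2, x > 0 and 0 < τ < 1, ∫_x^∞ (1 − 1/(1 + τ x^α ρ^{−α})) · ρ dρ = x² · Σ_{n=1}^∞ (−1)^{n+1} τ^n / (n α − 2), and the series converges absolutely. -/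
open Real MeasureTheory Set

theorem stmt9 (α x τ : ℝ) (hα : 2 < α) (hx : 0 < x) (hτ0 : 0 < τ) (hτ1 : τ < 1) :
    (∫ ρ in Set.Ioi x, (1 - 1 / (1 + τ * x ^ α * ρ ^ (-α))) * ρ) =
      x ^ 2 * ∑' m : ℕ, (-1 : ℝ) ^ m * τ ^ (m + 1) / (((m : ℝ) + 1) * α - 2) ∧
    Summable (fun m : ℕ =>
        |(-1 : ℝ) ^ m * τ ^ (m + 1) / (((m : ℝ) + 1) * α - 2)|) := by
  have hd : ∀ m : ℕ, α - 2 ≤ ((m : ℝ) + 1) * α - 2 := by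
    intro m
    have : 0 ≤ (m : ℝ) * α := by positivity
    linarith
  have hd0 : ∀ m : ℕ, 0 < ((m : ℝ) + 1) * α - 2 := fun m => by linarith [hd m]
  have habs : ∀ m : ℕ, |(-1 : ℝ) ^ m * τ ^ (m + 1) / (((m : ℝ) + 1) * α - 2)|
      = τ ^ (m + 1) / (((m : ℝ) + 1) * α - 2) := by
    intro m
    rw [abs_div, abs_mul, abs_pow, abs_neg, abs_one, one_pow, one_mul, abs_of_pos (hd0 m),
      abs_of_pos (by positivity)]
  have hS' : Summable (fun m : ℕ => τ ^ (m + 1) / (((m : ℝ) + 1) * α - 2)) := by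
    have hg : Summable (fun m : ℕ => τ ^ m * (τ / (α - 2))) :=
      (summable_geometric_of_lt_one hτ0.le hτ1).mul_right _
    refine Summable.of_nonneg_of_le (fun m => ?_) (fun m => ?_) hg
    · have := hd0 m
      positivity
    · rw [pow_succ, ← mul_div_assoc]
      have : 0 < α - 2 := by linarith
      exact div_le_div_of_nonneg_left (by positivity) this (hd m)
  have hS : Summable (fun m : ℕ =>
        |(-1 : ℝ) ^ m * τ ^ (m + 1) / (((m : ℝ) + 1) * α - 2)|) := by
    simpa only [habs] using hS'
  refine ⟨?_, hS⟩
  have hlt : ∀ m : ℕ, 1 - ((m : ℝ) + 1) * α < -1 := fun m => by linarith [hd0 m]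
  have hint : ∀ m : ℕ, (τ * x ^ α) ^ (m + 1) * ∫ ρ in Ioi x, ρ ^ (1 - ((m : ℝ) + 1) * α)
      = x ^ 2 * (τ ^ (m + 1) / (((m : ℝ) + 1) * α - 2)) := by
    intro m
    rw [integral_Ioi_rpow_of_lt (hlt m) hx]
    have h1 : (x ^ α) ^ (m + 1) * x ^ (1 - ((m : ℝ) + 1) * α + 1) = x ^ 2 := by
      rw [← rpow_natCast, ← rpow_mul hx.le, ← rpow_add hx, ← rpow_natCast]
      congr 1
      push_cast
      ring
    have h2 : (1 - ((m : ℝ) + 1) * α + 1) = -(((m : ℝ) + 1) * α - 2) := by ring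
    rw [← h1, mul_pow]
    generalize x ^ (1 - ((m : ℝ) + 1) * α + 1) = y
    rw [h2, neg_div_neg_eq]
    ring
  let F : ℕ → ℝ → ℝ := fun m ρ => ((-1) ^ m * (τ * x ^ α) ^ (m + 1)) * ρ ^ (1 - ((m : ℝ) + 1) * α)
  have hFi : ∀ m, Integrable (F m) (volume.restrict (Ioi x)) := fun m =>
    (integrableOn_Ioi_rpow_of_lt (hlt m) hx).const_mul _
  have hFint : ∀ m, ∫ ρ in Ioi x, F m ρ
      = x ^ 2 * ((-1 : ℝ) ^ m * τ ^ (m + 1) / (((m : ℝ) + 1) * α - 2)) := by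
    intro m
    simp only [F]
    rw [integral_const_mul, mul_assoc, hint]
    ring
  have hFn : ∀ m, ∫ ρ in Ioi x, ‖F m ρ‖ = x ^ 2 * (τ ^ (m + 1) / (((m : ℝ) + 1) * α - 2)) := by
    intro m
    rw [← hint, ← integral_const_mul]
    refine setIntegral_congr_fun measurableSet_Ioi (fun ρ hρ => ?_)
    have hρ0 : 0 < ρ := hx.trans hρ
    simp only [F, norm_mul, norm_pow, norm_neg, norm_one, one_pow, one_mul]
    rw [Real.norm_of_nonneg hτ0.le, Real.norm_of_nonneg (by positivity : 0 ≤ x ^ α),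
      Real.norm_of_nonneg (by positivity)]
  have key := hasSum_integral_of_summable_integral_norm hFi (by
    simp only [hFn]
    exact hS'.mul_left _)
  simp only [hFint] at key
  rw [← tsum_mul_left, key.tsum_eq]
  refine setIntegral_congr_fun measurableSet_Ioi (fun ρ hρ => ?_)
  have hρ0 : 0 < ρ := hx.trans hρ
  set u := τ * x ^ α * ρ ^ (-α) with hu
  have hu0 : 0 < u := by positivity
  have hu1 : u < 1 := by
    have : x ^ α * ρ ^ (-α) < 1 := by
      rw [rpow_neg hρ0.le, ← div_eq_mul_inv, div_lt_one (by positivity)]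
      exact rpow_lt_rpow hx.le hρ (by linarith)
    have h3 : 0 < x ^ α * ρ ^ (-α) := by positivity
    rw [hu, mul_assoc]
    nlinarith
  have hF : ∀ m, F m ρ = (-u) ^ m * (u * ρ) := by
    intro m
    have : ρ ^ (1 - ((m : ℝ) + 1) * α) = (ρ ^ (-α)) ^ (m + 1) * ρ := by
      rw [← rpow_natCast, ← rpow_mul hρ0.le, ← rpow_add_one hρ0.ne']
      congr 1
      push_cast
      ring
    simp only [F]
    rw [this, neg_pow, hu]
    ring
  simp only [hF]
  rw [tsum_mul_right, tsum_geometric_of_abs_lt_one (by rw [abs_neg, abs_of_pos hu0]; exact hu1)]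
  have : 1 + u ≠ 0 := by positivity
  rw [sub_neg_eq_add]
  field_simp
  ring
end
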